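/- arXiv:1908.09643 — 5 statements merged into one kernel-verified Lean document; each statement's English description precedes it below -/
import Mathlib

section
/- Assume condition (2.8): ρ_l(σ^{bd}_{ac}) ∘ T_{deg(d)} ∘ T_{deg(b)} = ρ_r(σ^{bd}_{ac}) ∘ T_{deg(c)} ∘ T_{deg(a)} for all a,b,c,d ∈ X. Let ε̄ : k⟨Gen⟩ → End_k(L) be the unique k-algebra homomorphism determined on generators by ε̄(L_{ab}) = δ_{ab} T_{deg(a)}, ε̄((L⁻¹)_{ab}) = δ_{ab} T_{deg(a)⁻¹} (a,b ∈ X), and ε̄ restricted to L ⊗_k L^op being the k-linear map with ε̄(l ⊗ l') = ρ_l(l) ∘ ρ_r(l') for l, l' ∈ L. Then ε̄(I_σ) = {0}. -/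
open scoped TensorProduct
open MulOpposite

noncomputable section

set_option linter.unusedSectionVars false

variable (k L X G : Type*) [CommRing k] [Ring L] [Algebra k L] [Fintype X]
  [DecidableEq X] [Group G]

/-- The set `Gen` of generators: the underlying set of `L ⊗[k] Lᵐᵒᵖ` together with two
families of formal symbols `L_{ab}` and `(L⁻¹)_{ab}` indexed by `X × X`. -/
abbrev Gen : Type _ := (L ⊗[k] Lᵐᵒᵖ) ⊕ (X × X) ⊕ (X × X)

/-- The generator of `k⟨Gen⟩` corresponding to `ξ ∈ L ⊗[k] Lᵐᵒᵖ`. -/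
def iT (ξ : L ⊗[k] Lᵐᵒᵖ) : FreeAlgebra k (Gen k L X) := FreeAlgebra.ι k (Sum.inl ξ)

/-- The generator `L_{ab}` of `k⟨Gen⟩`. -/
def iL (a b : X) : FreeAlgebra k (Gen k L X) := FreeAlgebra.ι k (Sum.inr (Sum.inl (a, b)))

/-- The generator `(L⁻¹)_{ab}` of `k⟨Gen⟩`. -/
def iLi (a b : X) : FreeAlgebra k (Gen k L X) := FreeAlgebra.ι k (Sum.inr (Sum.inr (a, b)))

/-- `f ⊗ 1_L ∈ L ⊗[k] Lᵐᵒᵖ`. -/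
def sE (f : L) : L ⊗[k] Lᵐᵒᵖ := f ⊗ₜ[k] (1 : Lᵐᵒᵖ)

/-- `1_L ⊗ f ∈ L ⊗[k] Lᵐᵒᵖ`. -/
def tE (f : L) : L ⊗[k] Lᵐᵒᵖ := (1 : L) ⊗ₜ[k] (op f)

variable (deg : X → G) (T : G → L ≃ₐ[k] L) (σ : X → X → X → X → L)

/-- The set of generators (i)–(v) of the two-sided ideal `I_σ`. -/
def relSet : Set (FreeAlgebra k (Gen k L X)) :=
  {w | (∃ ξ ξ' : L ⊗[k] Lᵐᵒᵖ, w = iT k L X ξ + iT k L X ξ' - iT k L X (ξ + ξ')) ∨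
    (∃ (c : k) (ξ : L ⊗[k] Lᵐᵒᵖ), w = c • iT k L X ξ - iT k L X (c • ξ)) ∨
    (∃ ξ ξ' : L ⊗[k] Lᵐᵒᵖ, w = iT k L X ξ * iT k L X ξ' - iT k L X (ξ * ξ')) ∨
    (∃ a b : X, w = (∑ c : X, iL k L X a c * iLi k L X c b) - if a = b then 1 else 0) ∨
    (∃ a b : X, w = (∑ c : X, iLi k L X a c * iL k L X c b) - if a = b then 1 else 0) ∨
    (∃ (f : L) (a b : X),
      w = iT k L X (sE k L (T (deg a) f)) * iL k L X a b - iL k L X a b * iT k L X (sE k L f)) ∨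
    (∃ (f : L) (a b : X),
      w = iT k L X (tE k L (T (deg b) f)) * iL k L X a b - iL k L X a b * iT k L X (tE k L f)) ∨
    (∃ (f : L) (a b : X),
      w = iT k L X (sE k L f) * iLi k L X a b - iLi k L X a b * iT k L X (sE k L (T (deg b) f))) ∨
    (∃ (f : L) (a b : X),
      w = iT k L X (tE k L f) * iLi k L X a b - iLi k L X a b * iT k L X (tE k L (T (deg a) f))) ∨
    (∃ a b c d : X,
      w = (∑ x : X, ∑ y : X, iT k L X (sE k L (σ x y a c)) * iL k L X y d * iL k L X x b) -
        ∑ x : X, ∑ y : X, iT k L X (tE k L (σ b d x y)) * iL k L X c y * iL k L X a x) ∨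
    w = 1 - iT k L X (1 : L ⊗[k] Lᵐᵒᵖ)}

/-- The two-sided ideal `I_σ` of `k⟨Gen⟩`. -/
def Isig : TwoSidedIdeal (FreeAlgebra k (Gen k L X)) :=
  TwoSidedIdeal.span (relSet k L X G deg T σ)

/-- The quotient algebra `A_σ = k⟨Gen⟩ / I_σ`. -/
def Asig : Type _ := (Isig k L X G deg T σ).ringCon.Quotient

instance : Ring (Asig k L X G deg T σ) :=
  inferInstanceAs (Ring (RingCon.Quotient _))

/-- The quotient map `k⟨Gen⟩ → A_σ`, `w ↦ w + I_σ`. -/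
def mkA : FreeAlgebra k (Gen k L X) →+* Asig k L X G deg T σ := RingCon.mk' _

instance : Algebra k (Asig k L X G deg T σ) :=
  RingHom.toAlgebra' ((mkA k L X G deg T σ).comp (algebraMap k (FreeAlgebra k (Gen k L X))))
    (by
      intro c x
      obtain ⟨y, rfl⟩ := Quotient.mk''_surjective (α := FreeAlgebra k (Gen k L X)) x
      show mkA k L X G deg T σ _ * mkA k L X G deg T σ y =
        mkA k L X G deg T σ y * mkA k L X G deg T σ _
      rw [← map_mul, ← map_mul, Algebra.commutes])


/-- The `k`-linear map `L ⊗[k] L^{op} → End_k(L)` with `l ⊗ l' ↦ ρ_l(l) ∘ ρ_r(l')`. -/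
def rhoEnd : (L ⊗[k] Lᵐᵒᵖ) →ₗ[k] Module.End k L :=
  TensorProduct.lift (LinearMap.mk₂ k
    (fun (l : L) (m : Lᵐᵒᵖ) => LinearMap.mulLeft k l ∘ₗ LinearMap.mulRight k m.unop)
    (fun l l' m => by ext g; simp [add_mul])
    (fun c l m => by ext g; simp [smul_mul_assoc])
    (fun l m m' => by ext g; simp [mul_add])
    (fun c l m => by ext g; simp [mul_smul_comm]))

/-- The `k`-algebra homomorphism `ε̄ : k⟨Gen⟩ → End_k(L)`. -/
def epsbar : FreeAlgebra k (Gen k L X) →ₐ[k] Module.End k L :=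
  FreeAlgebra.lift k (fun g => match g with
    | Sum.inl ξ => rhoEnd k L ξ
    | Sum.inr (Sum.inl (a, b)) =>
        if a = b then ((T (deg a)).toLinearMap : Module.End k L) else 0
    | Sum.inr (Sum.inr (a, b)) =>
        if a = b then ((T (deg a)⁻¹).toLinearMap : Module.End k L) else 0)

@[simp]
lemma rhoEnd_tmul_apply (l : L) (m : Lᵐᵒᵖ) (g : L) :
    rhoEnd k L (l ⊗ₜ[k] m) g = l * (g * m.unop) := rfl

lemma rhoEnd_one : rhoEnd k L 1 = 1 := by
  ext g
  simp [Algebra.TensorProduct.one_def]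

lemma rhoEnd_mul (ξ ξ' : L ⊗[k] Lᵐᵒᵖ) :
    rhoEnd k L (ξ * ξ') = rhoEnd k L ξ * rhoEnd k L ξ' := by
  induction ξ using TensorProduct.induction_on with
  | zero => simp
  | add x y hx hy => rw [add_mul, map_add, map_add, add_mul, hx, hy]
  | tmul l m =>
    induction ξ' using TensorProduct.induction_on with
    | zero => simp
    | add x y hx hy => rw [mul_add, map_add, map_add, mul_add, hx, hy]
    | tmul l' m' =>
      ext g
      simp [mul_assoc]

@[simp]
lemma epsbar_iT (ξ : L ⊗[k] Lᵐᵒᵖ) : epsbar k L X G deg T (iT k L X ξ) = rhoEnd k L ξ := by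
  simp [epsbar, iT]

@[simp]
lemma epsbar_iL (a b : X) : epsbar k L X G deg T (iL k L X a b) =
    if a = b then ((T (deg a)).toLinearMap : Module.End k L) else 0 := by
  simp [epsbar, iL]

@[simp]
lemma epsbar_iLi (a b : X) : epsbar k L X G deg T (iLi k L X a b) =
    if a = b then ((T (deg a)⁻¹).toLinearMap : Module.End k L) else 0 := by
  simp [epsbar, iLi]

/-- Under condition (2.8), `ε̄` vanishes on the generators of `I_σ`. -/
lemma epsbar_relSet_eq_zero (hT : ∀ (α : G) (f : L), T α (T α⁻¹ f) = f)
    (h28 : ∀ a b c d : X, ∀ g : L,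
      σ b d a c * T (deg d) (T (deg b) g) = T (deg c) (T (deg a) g) * σ b d a c)
    {w : FreeAlgebra k (Gen k L X)} (hw : w ∈ relSet k L X G deg T σ) :
    epsbar k L X G deg T w = 0 := by
  have hT' (α : G) (f : L) : T α⁻¹ (T α f) = f := by simpa using hT α⁻¹ f
  rcases hw with ⟨ξ, ξ', rfl⟩ | ⟨c, ξ, rfl⟩ | ⟨ξ, ξ', rfl⟩ | ⟨a, b, rfl⟩ | ⟨a, b, rfl⟩ |
    ⟨f, a, b, rfl⟩ | ⟨f, a, b, rfl⟩ | ⟨f, a, b, rfl⟩ | ⟨f, a, b, rfl⟩ | ⟨a, b, c, d, rfl⟩ | rfl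
  · simp
  · simp
  · simp [rhoEnd_mul]
  · by_cases h : a = b
    · subst h
      ext g
      simp [hT]
    · simp [h]
  · by_cases h : a = b
    · subst h
      ext g
      simp [hT']
    · simp [h]
  iterate 4
    by_cases h : a = b
    · subst h
      ext g
      simp [sE, tE, hT']
    · simp [h]
  · ext g
    simp [sE, tE, h28]
  · simp [rhoEnd_one]

/-- Under condition (2.8), `ε̄(I_σ) = {0}`. -/
theorem epsbar_Isig_eq_zero (hT : ∀ (α : G) (f : L), T α (T α⁻¹ f) = f)
    (h28 : ∀ a b c d : X, ∀ g : L,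
      σ b d a c * T (deg d) (T (deg b) g) = T (deg c) (T (deg a) g) * σ b d a c) :
    ∀ x ∈ Isig k L X G deg T σ, epsbar k L X G deg T x = 0 := by
  intro x hx
  let J : TwoSidedIdeal (FreeAlgebra k (Gen k L X)) := TwoSidedIdeal.ker (epsbar k L X G deg T)
  have hJ : Isig k L X G deg T σ ≤ J := TwoSidedIdeal.span_le.2 fun w hw =>
    (TwoSidedIdeal.mem_ker _).2 (epsbar_relSet_eq_zero k L X G deg T σ hT h28 hw)
  exact (TwoSidedIdeal.mem_ker _).1 (hJ hx)

end
end

section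
/- Assume condition (3.6): T_{deg(a)⁻¹} ∘ T_{deg(c)⁻¹} ∘ ρ_l(σ^{bd}_{ac}) = T_{deg(b)⁻¹} ∘ T_{deg(d)⁻¹} ∘ ρ_r(σ^{bd}_{ac}) for all a,b,c,d ∈ X. Let ε̄' : k⟨Gen⟩ → End_k(L) be the unique k-algebra anti-homomorphism (equivalently, k-algebra homomorphism into End_k(L)^op) determined on generators by ε̄'(L_{ab}) = δ_{ab} T_{deg(a)⁻¹}, ε̄'((L⁻¹)_{ab}) = δ_{ab} T_{deg(a)} (a,b ∈ X), and ε̄' restricted to L ⊗_k L^op being the k-linear map with ε̄'(l ⊗ l') = ρ_l(l') ∘ ρ_r(l) for l, l' ∈ L. Then ε̄'(I_σ) = {0}. -/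
open scoped TensorProduct
open MulOpposite

noncomputable section

set_option linter.unusedSectionVars false

variable (k L X G : Type*) [CommRing k] [Ring L] [Algebra k L] [Fintype X]
  [DecidableEq X] [Group G]

variable (deg : X → G) (T : G → L ≃ₐ[k] L) (σ : X → X → X → X → L)

/-- The `k`-linear map `L ⊗[k] L^{op} → End_k(L)^{op}` with `l ⊗ l' ↦ ρ_l(l') ∘ ρ_r(l)`. -/
def rhoEnd' : (L ⊗[k] Lᵐᵒᵖ) →ₗ[k] (Module.End k L)ᵐᵒᵖ :=
  TensorProduct.lift (LinearMap.mk₂ k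
    (fun (l : L) (m : Lᵐᵒᵖ) => op (LinearMap.mulLeft k m.unop ∘ₗ LinearMap.mulRight k l))
    (fun l l' m => by rw [← op_add, op_inj]; ext g; simp [mul_add])
    (fun c l m => by rw [← op_smul, op_inj]; ext g; simp [mul_smul_comm])
    (fun l m m' => by rw [← op_add, op_inj]; ext g; simp [add_mul])
    (fun c l m => by rw [← op_smul, op_inj]; ext g; simp [smul_mul_assoc]))

/-- The `k`-algebra anti-homomorphism `ε̄' : k⟨Gen⟩ → End_k(L)`, viewed as a `k`-algebra
homomorphism `k⟨Gen⟩ → End_k(L)^{op}`. -/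
def epsbar' : FreeAlgebra k (Gen k L X) →ₐ[k] (Module.End k L)ᵐᵒᵖ :=
  FreeAlgebra.lift k (fun g => match g with
    | Sum.inl ξ => rhoEnd' k L ξ
    | Sum.inr (Sum.inl (a, b)) =>
        op (if a = b then ((T (deg a)⁻¹).toLinearMap : Module.End k L) else 0)
    | Sum.inr (Sum.inr (a, b)) =>
        op (if a = b then ((T (deg a)).toLinearMap : Module.End k L) else 0))

@[simp]
lemma rhoEnd'_tmul (l : L) (m : Lᵐᵒᵖ) :
    rhoEnd' k L (l ⊗ₜ[k] m) = op (LinearMap.mulLeft k m.unop ∘ₗ LinearMap.mulRight k l) :=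
  rfl

lemma rhoEnd'_one : rhoEnd' k L 1 = 1 := by
  rw [Algebra.TensorProduct.one_def, rhoEnd'_tmul]
  refine unop_injective ?_
  ext g
  simp

lemma rhoEnd'_mul (ξ ξ' : L ⊗[k] Lᵐᵒᵖ) :
    rhoEnd' k L (ξ * ξ') = rhoEnd' k L ξ * rhoEnd' k L ξ' := by
  induction ξ with
  | zero => simp
  | add ξ₁ ξ₂ h₁ h₂ => rw [add_mul, map_add, map_add, add_mul, h₁, h₂]
  | tmul l m =>
    induction ξ' with
    | zero => simp
    | add ξ₁ ξ₂ h₁ h₂ => rw [mul_add, map_add, map_add, mul_add, h₁, h₂]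
    | tmul l' m' =>
      rw [Algebra.TensorProduct.tmul_mul_tmul, rhoEnd'_tmul, rhoEnd'_tmul, rhoEnd'_tmul,
        ← op_mul, op_inj]
      ext g
      simp [mul_assoc]

lemma rhoEnd'_sE (f : L) : rhoEnd' k L (sE k L f) = op (LinearMap.mulRight k f) := by
  rw [sE, rhoEnd'_tmul, op_inj]
  ext g
  simp

lemma rhoEnd'_tE (f : L) : rhoEnd' k L (tE k L f) = op (LinearMap.mulLeft k f) := by
  rw [tE, rhoEnd'_tmul, op_inj]
  ext g
  simp

@[simp]
lemma epsbar'_iT (ξ : L ⊗[k] Lᵐᵒᵖ) :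
    epsbar' k L X G deg T (iT k L X ξ) = rhoEnd' k L ξ := by
  simp [epsbar', iT]

@[simp]
lemma epsbar'_iL (a b : X) :
    epsbar' k L X G deg T (iL k L X a b) =
      if a = b then op ((T (deg a)⁻¹).toLinearMap : Module.End k L) else 0 := by
  simp [epsbar', iL, apply_ite op]

@[simp]
lemma epsbar'_iLi (a b : X) :
    epsbar' k L X G deg T (iLi k L X a b) =
      if a = b then op ((T (deg a)).toLinearMap : Module.End k L) else 0 := by
  simp [epsbar', iLi, apply_ite op]

lemma epsbar'_eq_zero_of_mem_relSet (hT : ∀ (α : G) (f : L), T α (T α⁻¹ f) = f)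
    (h36 : ∀ a b c d : X, ∀ g : L,
      T (deg a)⁻¹ (T (deg c)⁻¹ (σ b d a c * g)) =
        T (deg b)⁻¹ (T (deg d)⁻¹ (g * σ b d a c)))
    {w : FreeAlgebra k (Gen k L X)} (hw : w ∈ relSet k L X G deg T σ) :
    epsbar' k L X G deg T w = 0 := by
  have hT' (α : G) (f : L) : T α⁻¹ (T α f) = f := by simpa using hT α⁻¹ f
  rcases hw with ⟨ξ, ξ', rfl⟩ | ⟨c, ξ, rfl⟩ | ⟨ξ, ξ', rfl⟩ | ⟨a, b, rfl⟩ | ⟨a, b, rfl⟩ |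
    ⟨f, a, b, rfl⟩ | ⟨f, a, b, rfl⟩ | ⟨f, a, b, rfl⟩ | ⟨f, a, b, rfl⟩ | ⟨a, b, c, d, rfl⟩ | rfl
  · simp
  · simp
  · simp [rhoEnd'_mul]
  · rw [map_sub, sub_eq_zero]
    by_cases hab : a = b
    · subst hab
      simp only [map_sum, map_mul, epsbar'_iL, epsbar'_iLi, ite_mul, mul_ite, zero_mul, mul_zero,
        Finset.sum_ite_eq', Finset.mem_univ, if_true, map_one]
      rw [← op_mul, ← op_one, op_inj]
      ext g
      simp [hT]
    · simp [hab]
  · rw [map_sub, sub_eq_zero]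
    by_cases hab : a = b
    · subst hab
      simp only [map_sum, map_mul, epsbar'_iL, epsbar'_iLi, ite_mul, mul_ite, zero_mul, mul_zero,
        Finset.sum_ite_eq', Finset.mem_univ, if_true, map_one]
      rw [← op_mul, ← op_one, op_inj]
      ext g
      simp [hT']
    · simp [hab]
  iterate 4
    rw [map_sub, sub_eq_zero]
    by_cases hab : a = b
    · subst hab
      simp only [map_mul, epsbar'_iT, epsbar'_iL, epsbar'_iLi, if_true, rhoEnd'_sE, rhoEnd'_tE]
      rw [← op_mul, ← op_mul, op_inj]
      ext g
      simp [hT']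
    · simp [hab]
  · rw [map_sub, sub_eq_zero]
    simp only [map_sum, map_mul, epsbar'_iT, epsbar'_iL, ite_mul, mul_ite, zero_mul, mul_zero,
      Finset.sum_ite_irrel, Finset.sum_const_zero, Finset.sum_ite_eq, Finset.sum_ite_eq',
      Finset.mem_univ, if_true, rhoEnd'_sE, rhoEnd'_tE]
    rw [← op_mul, ← op_mul, ← op_mul, ← op_mul, op_inj]
    ext g
    simpa using (h36 a b c d g).symm
  · simp [rhoEnd'_one]

/-- Under condition (3.6), `ε̄'(I_σ) = {0}`. -/
theorem epsbar'_Isig_eq_zero (hT : ∀ (α : G) (f : L), T α (T α⁻¹ f) = f)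
    (h36 : ∀ a b c d : X, ∀ g : L,
      T (deg a)⁻¹ (T (deg c)⁻¹ (σ b d a c * g)) =
        T (deg b)⁻¹ (T (deg d)⁻¹ (g * σ b d a c))) :
    ∀ x ∈ Isig k L X G deg T σ, epsbar' k L X G deg T x = 0 := by
  intro x hx
  have hle : Isig k L X G deg T σ ≤ TwoSidedIdeal.ker (epsbar' k L X G deg T) :=
    TwoSidedIdeal.span_le.2 fun w hw =>
      (TwoSidedIdeal.mem_ker _).2 (epsbar'_eq_zero_of_mem_relSet k L X G deg T σ hT h36 hw)
  exact (TwoSidedIdeal.mem_ker _).1 (hle hx)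

end
end

section
/- Assume σ satisfies condition (4.1): T_{deg(a)⁻¹}(T_{deg(c)⁻¹}(σ^{bd}_{ac})) = T_{deg(b)⁻¹}(T_{deg(d)⁻¹}(σ^{bd}_{ac})) for all a,b,c,d ∈ X. If there exists a k-algebra anti-automorphism S : A_σ → A_σ (a bijective k-linear map with S(1) = 1 and S(uv) = S(v)S(u)) such that S(f ⊗ 1_L + I_σ) = 1_L ⊗ f + I_σ and S(1_L ⊗ f + I_σ) = f ⊗ 1_L + I_σ for all f ∈ L and S(L_{ab} + I_σ) = (L⁻¹)_{ab} + I_σ for all a,b ∈ X, then σ is rigid. -/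
open scoped TensorProduct
open MulOpposite

noncomputable section

set_option linter.unusedSectionVars false

variable (k L X G : Type*) [CommRing k] [Ring L] [Algebra k L] [Fintype X]
  [DecidableEq X] [Group G]

variable (deg : X → G) (T : G → L ≃ₐ[k] L) (σ : X → X → X → X → L)

/-- `σ` is rigid: there are families `x y : X → X → A_σ` satisfying the four
defining equations. -/
def IsRigid : Prop :=
  ∃ x y : X → X → Asig k L X G deg T σ, ∀ a b : X,
    (∑ c : X, mkA k L X G deg T σ (iLi k L X c b) * x a c) = (if a = b then 1 else 0) ∧
    (∑ c : X, x c b * mkA k L X G deg T σ (iLi k L X a c)) = (if a = b then 1 else 0) ∧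
    (∑ c : X, mkA k L X G deg T σ (iL k L X c b) * y a c) = (if a = b then 1 else 0) ∧
    (∑ c : X, y c b * mkA k L X G deg T σ (iL k L X a c)) = (if a = b then 1 else 0)

theorem mkA_eq_zero_of_mem_relSet {w : FreeAlgebra k (Gen k L X)}
    (hw : w ∈ relSet k L X G deg T σ) : mkA k L X G deg T σ w = 0 :=
  (RingCon.eq _).2 ((TwoSidedIdeal.mem_iff _ _).1 (TwoSidedIdeal.subset_span hw))

theorem sum_mkA_iL_mul_iLi (a b : X) :
    ∑ c : X, mkA k L X G deg T σ (iL k L X a c) * mkA k L X G deg T σ (iLi k L X c b) =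
      if a = b then 1 else 0 := by
  have h := mkA_eq_zero_of_mem_relSet k L X G deg T σ
    (w := (∑ c : X, iL k L X a c * iLi k L X c b) - if a = b then 1 else 0)
    (Or.inr (Or.inr (Or.inr (Or.inl ⟨a, b, rfl⟩))))
  rw [map_sub, sub_eq_zero] at h
  simpa [apply_ite (mkA k L X G deg T σ)] using h

theorem sum_mkA_iLi_mul_iL (a b : X) :
    ∑ c : X, mkA k L X G deg T σ (iLi k L X a c) * mkA k L X G deg T σ (iL k L X c b) =
      if a = b then 1 else 0 := by
  have h := mkA_eq_zero_of_mem_relSet k L X G deg T σ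
    (w := (∑ c : X, iLi k L X a c * iL k L X c b) - if a = b then 1 else 0)
    (Or.inr (Or.inr (Or.inr (Or.inr (Or.inl ⟨a, b, rfl⟩)))))
  rw [map_sub, sub_eq_zero] at h
  simpa [apply_ite (mkA k L X G deg T σ)] using h

/-- If there is a `k`-algebra anti-automorphism `S` of `A_σ` with the prescribed values on
the generators, then `σ` is rigid. -/
theorem isRigid_of_antiAut (hT : ∀ (α : G) (f : L), T α (T α⁻¹ f) = f)
    (h41 : ∀ a b c d : X,
      T (deg a)⁻¹ (T (deg c)⁻¹ (σ b d a c)) = T (deg b)⁻¹ (T (deg d)⁻¹ (σ b d a c)))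
    (S : Asig k L X G deg T σ →ₗ[k] Asig k L X G deg T σ)
    (hbij : Function.Bijective S) (hone : S 1 = 1)
    (hanti : ∀ u v : Asig k L X G deg T σ, S (u * v) = S v * S u)
    (hsf : ∀ f : L, S (mkA k L X G deg T σ (iT k L X (sE k L f))) =
      mkA k L X G deg T σ (iT k L X (tE k L f)))
    (htf : ∀ f : L, S (mkA k L X G deg T σ (iT k L X (tE k L f))) =
      mkA k L X G deg T σ (iT k L X (sE k L f)))
    (hLab : ∀ a b : X, S (mkA k L X G deg T σ (iL k L X a b)) =
      mkA k L X G deg T σ (iLi k L X a b)) :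
    IsRigid k L X G deg T σ := by
  have hδ (a b : X) : S (if a = b then 1 else 0) = if a = b then 1 else 0 := by
    rw [apply_ite S, hone, map_zero]
  choose y hy using fun a b : X => hbij.surjective (mkA k L X G deg T σ (iL k L X a b))
  refine ⟨fun a b => S (mkA k L X G deg T σ (iLi k L X a b)), y, fun a b => ⟨?_, ?_, ?_, ?_⟩⟩
  · simpa only [map_sum, hanti, hLab, hδ] using congrArg S (sum_mkA_iLi_mul_iL k L X G deg T σ a b)
  · simpa only [map_sum, hanti, hLab, hδ] using congrArg S (sum_mkA_iL_mul_iLi k L X G deg T σ a b)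
  · apply hbij.injective
    simpa only [map_sum, hanti, hLab, hy, hδ] using sum_mkA_iL_mul_iLi k L X G deg T σ a b
  · apply hbij.injective
    simpa only [map_sum, hanti, hLab, hy, hδ] using sum_mkA_iLi_mul_iL k L X G deg T σ a b

end
end

section
/- Assume σ satisfies condition (4.1): T_{deg(a)⁻¹}(T_{deg(c)⁻¹}(σ^{bd}_{ac})) = T_{deg(b)⁻¹}(T_{deg(d)⁻¹}(σ^{bd}_{ac})) for all a,b,c,d ∈ X, and assume σ is rigid. Then there exists a k-algebra anti-automorphism S : A_σ → A_σ (a bijective k-linear map with S(1) = 1 and S(uv) = S(v)S(u)) such that S(f ⊗ 1_L + I_σ) = 1_L ⊗ f + I_σ and S(1_L ⊗ f + I_σ) = f ⊗ 1_L + I_σ for all f ∈ L, and S(L_{ab} + I_σ) = (L⁻¹)_{ab} + I_σ for all a,b ∈ X. -/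
open scoped TensorProduct
open MulOpposite

noncomputable section

set_option linter.unusedSectionVars false

variable (k L X G : Type*) [CommRing k] [Ring L] [Algebra k L] [Fintype X]
  [DecidableEq X] [Group G]

variable (deg : X → G) (T : G → L ≃ₐ[k] L) (σ : X → X → X → X → L)

section Intertwining

variable {k L X G} {R : Type*} [Ring R]

theorem intertwine_inverse {M N : Matrix X X R} (hMN : M * N = 1) (hNM : N * M = 1)
    {u v : X → R} (h : ∀ a b, M a b * v b = u a * M a b) (a b : X) :
    N a b * u b = v a * N a b := by
  have hM : M * Matrix.diagonal v = Matrix.diagonal u * M := by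
    ext a b
    simp [h]
  have hN : N * Matrix.diagonal u = Matrix.diagonal v * N := by
    calc N * Matrix.diagonal u = N * (Matrix.diagonal u * M) * N := by
          rw [Matrix.mul_assoc, Matrix.mul_assoc, hMN, Matrix.mul_one]
      _ = Matrix.diagonal v * N := by
          rw [← hM, ← Matrix.mul_assoc, hNM, Matrix.one_mul]
  simpa using congrFun (congrFun hN a) b

/-- The exchange relation for `M` turns into the reversed exchange relation for its inverse. -/
theorem exchange_inverse {M N : X → X → R} {s t : L → R} {deg : X → G} {T : G → L ≃ₐ[k] L}
    {σ : X → X → X → X → L} (hT : ∀ (α : G) (f : L), T α (T α⁻¹ f) = f)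
    (h41 : ∀ a b c d : X,
      T (deg a)⁻¹ (T (deg c)⁻¹ (σ b d a c)) = T (deg b)⁻¹ (T (deg d)⁻¹ (σ b d a c)))
    (hMN : ∀ a b, ∑ c, M a c * N c b = if a = b then 1 else 0)
    (hNM : ∀ a b, ∑ c, N a c * M c b = if a = b then 1 else 0)
    (hM : ∀ f a b, t (T (deg b) f) * M a b = M a b * t f)
    (hN : ∀ f a b, t f * N a b = N a b * t (T (deg a) f))
    (hσ : ∀ a b c d, ∑ x, ∑ y, s (σ x y a c) * M y d * M x b =
      ∑ x, ∑ y, t (σ b d x y) * M c y * M a x) (p q u v : X) :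
    ∑ x, ∑ y, N x p * N y q * t (σ x y v u) = ∑ x, ∑ y, N v x * N u y * s (σ p q x y) := by
  have hM' : ∀ (f : L) (a c x y : X), t f * M c y * M a x =
      M c y * M a x * t (T (deg x)⁻¹ (T (deg y)⁻¹ f)) := by
    intro f a c x y
    have h1 := hM (T (deg y)⁻¹ f) c y
    have h2 := hM (T (deg x)⁻¹ (T (deg y)⁻¹ f)) a x
    rw [hT] at h1 h2
    rw [h1, mul_assoc, h2, mul_assoc]
  have hN' : ∀ (f : L) (b d : X), t (T (deg b)⁻¹ (T (deg d)⁻¹ f)) * (N b p * N d q) =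
      N b p * N d q * t f := by
    intro f b d
    rw [← mul_assoc, hN, hT, mul_assoc, hN, hT, mul_assoc]
  have key : ∀ a c, s (σ p q a c) =
      ∑ b, ∑ d, ∑ x, ∑ y, t (σ b d x y) * M c y * M a x * (N b p * N d q) := by
    intro a c
    calc s (σ p q a c)
        = ∑ y, ∑ x, s (σ x y a c) * (∑ d, M y d * (∑ b, M x b * N b p) * N d q) := by
          simp only [hMN, mul_ite, mul_one, mul_zero, ite_mul, zero_mul, Finset.sum_ite_irrel,
            Finset.sum_const_zero, Finset.sum_ite_eq', Finset.mem_univ, if_true]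
      _ = ∑ b, ∑ d, (∑ x, ∑ y, s (σ x y a c) * M y d * M x b) * (N b p * N d q) := by
          simp only [Finset.mul_sum, Finset.sum_mul, mul_assoc]
          simp only [← Finset.sum_product']
          refine Finset.sum_bij' (fun z _ => (z.2.2.2, z.2.2.1, z.2.1, z.1))
            (fun z _ => (z.2.2.2, z.2.2.1, z.2.1, z.1)) ?_ ?_ ?_ ?_ ?_ <;> simp
      _ = _ := by simp only [hσ, Finset.sum_mul]
  symm
  calc ∑ a, ∑ c, N v a * N u c * s (σ p q a c)
      = ∑ b, ∑ d, ∑ x, ∑ y, (∑ a, N v a * (∑ c, N u c * M c y) * M a x) *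
          (t (T (deg x)⁻¹ (T (deg y)⁻¹ (σ b d x y))) * (N b p * N d q)) := by
        simp only [key, hM', Finset.mul_sum, Finset.sum_mul, mul_assoc]
        simp only [← Finset.sum_product']
        refine Finset.sum_bij'
          (fun z _ => (z.2.2.1, z.2.2.2.1, z.2.2.2.2.1, z.2.2.2.2.2, z.1, z.2.1))
          (fun z _ => (z.2.2.2.2.1, z.2.2.2.2.2, z.1, z.2.1, z.2.2.1, z.2.2.2.1))
          ?_ ?_ ?_ ?_ ?_ <;> simp
    _ = ∑ b, ∑ d, N b p * N d q * t (σ b d v u) := by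
        simp only [hNM, mul_ite, mul_one, mul_zero, ite_mul, zero_mul, Finset.sum_ite_eq,
          Finset.sum_ite_irrel, Finset.sum_const_zero, Finset.mem_univ, if_true, h41, hN', one_mul]

end Intertwining

/-- The canonical map `k⟨Gen⟩ → A_σ` as a homomorphism of `k`-algebras. -/
def mkAlgHom : FreeAlgebra k (Gen k L X) →ₐ[k] Asig k L X G deg T σ :=
  { mkA k L X G deg T σ with commutes' := fun _ => rfl }

theorem mkA_surjective : Function.Surjective (mkA k L X G deg T σ) :=
  Quotient.mk''_surjective

variable {k L X G deg T σ}

theorem mkA_eq_of_sub_mem {u v : FreeAlgebra k (Gen k L X)}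
    (h : u - v ∈ relSet k L X G deg T σ) :
    mkA k L X G deg T σ u = mkA k L X G deg T σ v := by
  have h' : u - v ∈ Isig k L X G deg T σ := TwoSidedIdeal.subset_span h
  exact (RingCon.eq _).2 ((TwoSidedIdeal.rel_iff _ _ _).2 h')

theorem mkA_smul (c : k) (w : FreeAlgebra k (Gen k L X)) :
    mkA k L X G deg T σ (c • w) = c • mkA k L X G deg T σ w :=
  map_smul (mkAlgHom k L X G deg T σ) c w

variable (k L X G deg T σ)

/-- The canonical homomorphism `L ⊗ Lᵒᵖ → A_σ`. -/
def baseHom : L ⊗[k] Lᵐᵒᵖ →ₐ[k] Asig k L X G deg T σ :=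
  AlgHom.ofLinearMap
    { toFun := fun ξ => mkA k L X G deg T σ (iT k L X ξ)
      map_add' := fun ξ ξ' => by
        rw [← map_add]
        exact (mkA_eq_of_sub_mem (Or.inl ⟨ξ, ξ', rfl⟩)).symm
      map_smul' := fun c ξ => by
        rw [RingHom.id_apply, ← mkA_smul]
        exact (mkA_eq_of_sub_mem (Or.inr (Or.inl ⟨c, ξ, rfl⟩))).symm }
    (by
      show mkA k L X G deg T σ (iT k L X 1) = 1
      rw [← map_one (mkA k L X G deg T σ)]
      refine (mkA_eq_of_sub_mem ?_).symm
      unfold relSet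
      simp only [Set.mem_ofPred_eq, or_true])
    (fun ξ ξ' => by
      show mkA k L X G deg T σ (iT k L X (ξ * ξ')) =
        mkA k L X G deg T σ (iT k L X ξ) * mkA k L X G deg T σ (iT k L X ξ')
      rw [← map_mul]
      exact (mkA_eq_of_sub_mem (Or.inr (Or.inr (Or.inl ⟨ξ, ξ', rfl⟩)))).symm)

/-- The class of `f ⊗ 1` in `A_σ`. -/
def src (f : L) : Asig k L X G deg T σ := mkA k L X G deg T σ (iT k L X (sE k L f))

/-- The class of `1 ⊗ f` in `A_σ`. -/
def tgt (f : L) : Asig k L X G deg T σ := mkA k L X G deg T σ (iT k L X (tE k L f))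

/-- The class of `L_{ab}` in `A_σ`. -/
def entry (a b : X) : Asig k L X G deg T σ := mkA k L X G deg T σ (iL k L X a b)

/-- The class of `(L⁻¹)_{ab}` in `A_σ`. -/
def entryInv (a b : X) : Asig k L X G deg T σ := mkA k L X G deg T σ (iLi k L X a b)

/-- The defining relations of `A_σ` between the generators, in an arbitrary `k`-algebra. -/
structure ExchangeRel {B : Type*} [Ring B] (s t : L → B) (M N : X → X → B) : Prop where
  mul_inv : ∀ a b, ∑ c, M a c * N c b = if a = b then 1 else 0
  inv_mul : ∀ a b, ∑ c, N a c * M c b = if a = b then 1 else 0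
  src_mul : ∀ f a b, s (T (deg a) f) * M a b = M a b * s f
  tgt_mul : ∀ f a b, t (T (deg b) f) * M a b = M a b * t f
  src_mul_inv : ∀ f a b, s f * N a b = N a b * s (T (deg b) f)
  tgt_mul_inv : ∀ f a b, t f * N a b = N a b * t (T (deg a) f)
  exchange : ∀ a b c d, ∑ x, ∑ y, s (σ x y a c) * M y d * M x b =
    ∑ x, ∑ y, t (σ b d x y) * M c y * M a x

theorem exchangeRel_Asig : ExchangeRel k L X G deg T σ (src k L X G deg T σ)
    (tgt k L X G deg T σ) (entry k L X G deg T σ) (entryInv k L X G deg T σ) where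
  mul_inv a b := by
    have h := mkA_eq_of_sub_mem (Or.inr (Or.inr (Or.inr (Or.inl ⟨a, b, rfl⟩))) :
      _ ∈ relSet k L X G deg T σ)
    simpa [apply_ite (mkA k L X G deg T σ), entry, entryInv] using h
  inv_mul a b := by
    have h := mkA_eq_of_sub_mem (Or.inr (Or.inr (Or.inr (Or.inr (Or.inl ⟨a, b, rfl⟩)))) :
      _ ∈ relSet k L X G deg T σ)
    simpa [apply_ite (mkA k L X G deg T σ), entry, entryInv] using h
  src_mul f a b := by
    have h := mkA_eq_of_sub_mem (Or.inr (Or.inr (Or.inr (Or.inr (Or.inr (Or.inl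
      ⟨f, a, b, rfl⟩))))) : _ ∈ relSet k L X G deg T σ)
    simpa [src, tgt, entry, entryInv] using h
  tgt_mul f a b := by
    have h := mkA_eq_of_sub_mem (Or.inr (Or.inr (Or.inr (Or.inr (Or.inr (Or.inr (Or.inl
      ⟨f, a, b, rfl⟩)))))) : _ ∈ relSet k L X G deg T σ)
    simpa [src, tgt, entry, entryInv] using h
  src_mul_inv f a b := by
    have h := mkA_eq_of_sub_mem (Or.inr (Or.inr (Or.inr (Or.inr (Or.inr (Or.inr (Or.inr (Or.inl
      ⟨f, a, b, rfl⟩))))))) : _ ∈ relSet k L X G deg T σ)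
    simpa [src, tgt, entry, entryInv] using h
  tgt_mul_inv f a b := by
    have h := mkA_eq_of_sub_mem (Or.inr (Or.inr (Or.inr (Or.inr (Or.inr (Or.inr (Or.inr (Or.inr
      (Or.inl ⟨f, a, b, rfl⟩)))))))) : _ ∈ relSet k L X G deg T σ)
    simpa [src, tgt, entry, entryInv] using h
  exchange a b c d := by
    have h := mkA_eq_of_sub_mem (Or.inr (Or.inr (Or.inr (Or.inr (Or.inr (Or.inr (Or.inr (Or.inr
      (Or.inr (Or.inl ⟨a, b, c, d, rfl⟩))))))))) : _ ∈ relSet k L X G deg T σ)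
    simpa [src, tgt, entry, entryInv] using h

variable {k L X G deg T σ}

/-- The universal property of `A_σ`. -/
theorem exists_lift {B : Type*} [Ring B] [Algebra k B] (φ : L ⊗[k] Lᵐᵒᵖ →ₐ[k] B)
    {M N : X → X → B} (h : ExchangeRel k L X G deg T σ (fun f => φ (sE k L f))
      (fun f => φ (tE k L f)) M N) :
    ∃ F : Asig k L X G deg T σ →ₐ[k] B,
      (∀ ξ, F (baseHom k L X G deg T σ ξ) = φ ξ) ∧
      (∀ a b, F (entry k L X G deg T σ a b) = M a b) ∧
      (∀ a b, F (entryInv k L X G deg T σ a b) = N a b) := by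
  let F₀ : FreeAlgebra k (Gen k L X) →ₐ[k] B :=
    FreeAlgebra.lift k (Sum.elim φ (Sum.elim (fun p => M p.1 p.2) (fun p => N p.1 p.2)))
  have hT : ∀ ξ, F₀ (iT k L X ξ) = φ ξ := fun ξ => by simp [F₀, iT]
  have hL : ∀ a b, F₀ (iL k L X a b) = M a b := fun a b => by simp [F₀, iL]
  have hLi : ∀ a b, F₀ (iLi k L X a b) = N a b := fun a b => by simp [F₀, iLi]
  have hle : Isig k L X G deg T σ ≤ TwoSidedIdeal.ker F₀ := by
    refine TwoSidedIdeal.span_le.2 fun w hw => ?_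
    rw [SetLike.mem_coe, TwoSidedIdeal.mem_ker]
    obtain ⟨ξ, ξ', rfl⟩ | ⟨c, ξ, rfl⟩ | ⟨ξ, ξ', rfl⟩ | ⟨a, b, rfl⟩ | ⟨a, b, rfl⟩ | ⟨f, a, b, rfl⟩ |
      ⟨f, a, b, rfl⟩ | ⟨f, a, b, rfl⟩ | ⟨f, a, b, rfl⟩ | ⟨a, b, c, d, rfl⟩ | rfl := hw
    · simp [hT]
    · simp [hT]
    · simp [hT]
    · simp [hL, hLi, h.mul_inv, apply_ite F₀]
    · simp [hL, hLi, h.inv_mul, apply_ite F₀]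
    · simp [hT, hL, h.src_mul]
    · simp [hT, hL, h.tgt_mul]
    · simp [hT, hLi, h.src_mul_inv]
    · simp [hT, hLi, h.tgt_mul_inv]
    · simp [hT, hL, h.exchange]
    · simp [hT]
  let F₁ : Asig k L X G deg T σ →+* B := RingCon.lift _ F₀.toRingHom fun x y hxy => by
    have := hle ((TwoSidedIdeal.rel_iff _ _ _).1 hxy)
    rw [TwoSidedIdeal.mem_ker, map_sub, sub_eq_zero] at this
    exact this
  have hF₁ : ∀ w, F₁ (mkA k L X G deg T σ w) = F₀ w := fun w => rfl
  refine ⟨{ F₁ with commutes' := fun c => ?_ }, fun ξ => ?_, fun a b => ?_, fun a b => ?_⟩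
  · exact (hF₁ _).trans (F₀.commutes c)
  · exact (hF₁ _).trans (hT ξ)
  · exact (hF₁ _).trans (hL a b)
  · exact (hF₁ _).trans (hLi a b)

theorem algHom_ext_Asig {B : Type*} [Ring B] [Algebra k B] {F F' : Asig k L X G deg T σ →ₐ[k] B}
    (hs : ∀ f, F (src k L X G deg T σ f) = F' (src k L X G deg T σ f))
    (ht : ∀ f, F (tgt k L X G deg T σ f) = F' (tgt k L X G deg T σ f))
    (hL : ∀ a b, F (entry k L X G deg T σ a b) = F' (entry k L X G deg T σ a b))
    (hLi : ∀ a b, F (entryInv k L X G deg T σ a b) = F' (entryInv k L X G deg T σ a b)) :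
    F = F' := by
  have hbase : F.comp (baseHom k L X G deg T σ) = F'.comp (baseHom k L X G deg T σ) := by
    refine Algebra.TensorProduct.ext (AlgHom.ext hs) (AlgHom.ext fun f => ht (unop f))
  have hfree : F.comp (mkAlgHom k L X G deg T σ) = F'.comp (mkAlgHom k L X G deg T σ) := by
    refine FreeAlgebra.hom_ext (funext ?_)
    rintro (ξ | ⟨a, b⟩ | ⟨a, b⟩)
    · exact DFunLike.congr_fun hbase ξ
    · exact hL a b
    · exact hLi a b
  refine AlgHom.ext fun x => ?_
  obtain ⟨w, rfl⟩ := mkA_surjective k L X G deg T σ x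
  exact DFunLike.congr_fun hfree w

variable (k L X G deg T σ)

/-- The homomorphism `L ⊗ Lᵒᵖ → A_σᵒᵖ` exchanging the two tensor factors. -/
def flipHom : L ⊗[k] Lᵐᵒᵖ →ₐ[k] (Asig k L X G deg T σ)ᵐᵒᵖ :=
  Algebra.TensorProduct.lift
    (AlgHom.opComm.symm ((baseHom k L X G deg T σ).comp Algebra.TensorProduct.includeRight))
    (AlgHom.op ((baseHom k L X G deg T σ).comp Algebra.TensorProduct.includeLeft))
    (fun f g => by
      refine unop_injective ?_
      show baseHom k L X G deg T σ _ * baseHom k L X G deg T σ _ =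
        baseHom k L X G deg T σ _ * baseHom k L X G deg T σ _
      rw [← map_mul, ← map_mul]
      simp)

theorem flipHom_sE (f : L) :
    flipHom k L X G deg T σ (sE k L f) = op (tgt k L X G deg T σ f) := by
  refine (Algebra.TensorProduct.lift_tmul _ _ _ _ _).trans ?_
  rw [map_one, mul_one]
  rfl

theorem flipHom_tE (f : L) :
    flipHom k L X G deg T σ (tE k L f) = op (src k L X G deg T σ f) := by
  refine (Algebra.TensorProduct.lift_tmul _ _ _ _ _).trans ?_
  rw [map_one, one_mul]
  rfl

variable {k L X G deg T σ}

theorem exists_antiHom {M N : X → X → Asig k L X G deg T σ}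
    (h : ExchangeRel k L X G deg T σ (fun f => op (tgt k L X G deg T σ f))
      (fun f => op (src k L X G deg T σ f)) (fun a b => op (M a b)) (fun a b => op (N a b))) :
    ∃ F : Asig k L X G deg T σ →ₐ[k] (Asig k L X G deg T σ)ᵐᵒᵖ,
      (∀ f, F (src k L X G deg T σ f) = op (tgt k L X G deg T σ f)) ∧
      (∀ f, F (tgt k L X G deg T σ f) = op (src k L X G deg T σ f)) ∧
      (∀ a b, F (entry k L X G deg T σ a b) = op (M a b)) ∧
      (∀ a b, F (entryInv k L X G deg T σ a b) = op (N a b)) := by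
  obtain ⟨F, hF, hM, hN⟩ := exists_lift (flipHom k L X G deg T σ) (M := fun a b => op (M a b))
    (N := fun a b => op (N a b)) (by simpa only [flipHom_sE, flipHom_tE] using h)
  exact ⟨F, fun f => (hF _).trans (flipHom_sE k L X G deg T σ f),
    fun f => (hF _).trans (flipHom_tE k L X G deg T σ f), hM, hN⟩

theorem twist_inv_twist (hT : ∀ (α : G) (f : L), T α (T α⁻¹ f) = f) (α : G) (f : L) :
    T α⁻¹ (T α f) = f :=
  (T α).injective (hT α _)

theorem exchangeRel_antipode (hT : ∀ (α : G) (f : L), T α (T α⁻¹ f) = f)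
    (h41 : ∀ a b c d : X,
      T (deg a)⁻¹ (T (deg c)⁻¹ (σ b d a c)) = T (deg b)⁻¹ (T (deg d)⁻¹ (σ b d a c)))
    {x : X → X → Asig k L X G deg T σ}
    (hx : ∀ a b, ∑ c, entryInv k L X G deg T σ c b * x a c = if a = b then 1 else 0)
    (hx' : ∀ a b, ∑ c, x c b * entryInv k L X G deg T σ a c = if a = b then 1 else 0) :
    ExchangeRel k L X G deg T σ (fun f => op (tgt k L X G deg T σ f))
      (fun f => op (src k L X G deg T σ f)) (fun a b => op (entryInv k L X G deg T σ a b))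
      (fun a b => op (x a b)) := by
  have hA := exchangeRel_Asig k L X G deg T σ
  have hMN : (Matrix.of fun a b => entryInv k L X G deg T σ b a) * (Matrix.of fun a b => x b a) =
      1 := by
    ext a b
    simp [Matrix.mul_apply, hx, Matrix.one_apply, eq_comm]
  have hNM : (Matrix.of fun a b => x b a) * (Matrix.of fun a b => entryInv k L X G deg T σ b a) =
      1 := by
    ext a b
    simp [Matrix.mul_apply, hx', Matrix.one_apply, eq_comm]
  constructor
  · intro a b
    refine unop_injective ?_
    simpa [apply_ite unop] using hx' a b
  · intro a b
    refine unop_injective ?_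
    simpa [apply_ite unop] using hx a b
  · intro f a b
    exact unop_injective (hA.tgt_mul_inv f a b).symm
  · intro f a b
    exact unop_injective (hA.src_mul_inv f a b).symm
  · intro f a b
    refine unop_injective ?_
    exact intertwine_inverse hMN hNM (u := fun _ => tgt k L X G deg T σ f)
      (v := fun c => tgt k L X G deg T σ (T (deg c) f))
      (fun c d => (hA.tgt_mul_inv f d c).symm) b a
  · intro f a b
    refine unop_injective ?_
    have := intertwine_inverse hMN hNM
      (u := fun c => src k L X G deg T σ (T (deg c)⁻¹ (T (deg a) f)))
      (v := fun _ => src k L X G deg T σ (T (deg a) f))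
      (fun c d => by
        have h := hA.src_mul_inv (T (deg c)⁻¹ (T (deg a) f)) d c
        rw [hT] at h
        exact h.symm) b a
    rw [twist_inv_twist hT] at this
    exact this
  · intro a b c d
    refine unop_injective ?_
    have := exchange_inverse hT h41 hA.mul_inv hA.inv_mul hA.tgt_mul hA.tgt_mul_inv
      hA.exchange b d c a
    simpa [mul_assoc] using this

theorem exchangeRel_antipodeInv (hT : ∀ (α : G) (f : L), T α (T α⁻¹ f) = f)
    (h41 : ∀ a b c d : X,
      T (deg a)⁻¹ (T (deg c)⁻¹ (σ b d a c)) = T (deg b)⁻¹ (T (deg d)⁻¹ (σ b d a c)))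
    {y : X → X → Asig k L X G deg T σ}
    (hy : ∀ a b, ∑ c, entry k L X G deg T σ c b * y a c = if a = b then 1 else 0)
    (hy' : ∀ a b, ∑ c, y c b * entry k L X G deg T σ a c = if a = b then 1 else 0) :
    ExchangeRel k L X G deg T σ (fun f => op (tgt k L X G deg T σ f))
      (fun f => op (src k L X G deg T σ f)) (fun a b => op (y a b))
      (fun a b => op (entry k L X G deg T σ a b)) := by
  have hA := exchangeRel_Asig k L X G deg T σ
  have hMN : (Matrix.of fun a b => entry k L X G deg T σ b a) * (Matrix.of fun a b => y b a) =
      1 := by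
    ext a b
    simp [Matrix.mul_apply, hy, Matrix.one_apply, eq_comm]
  have hNM : (Matrix.of fun a b => y b a) * (Matrix.of fun a b => entry k L X G deg T σ b a) =
      1 := by
    ext a b
    simp [Matrix.mul_apply, hy', Matrix.one_apply, eq_comm]
  have htgt : ∀ f a b, y a b * tgt k L X G deg T σ (T (deg a) f) =
      tgt k L X G deg T σ f * y a b := fun f a b =>
    intertwine_inverse hMN hNM (u := fun c => tgt k L X G deg T σ (T (deg c) f))
      (v := fun _ => tgt k L X G deg T σ f) (fun c d => (hA.tgt_mul f d c).symm) b a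
  have hsrc : ∀ f a b, y a b * src k L X G deg T σ (T (deg b) f) =
      src k L X G deg T σ f * y a b := by
    intro f a b
    have := intertwine_inverse hMN hNM (u := fun _ => src k L X G deg T σ (T (deg b) f))
      (v := fun c => src k L X G deg T σ (T (deg c)⁻¹ (T (deg b) f)))
      (fun c d => by
        have h := hA.src_mul (T (deg d)⁻¹ (T (deg b) f)) d c
        rw [hT] at h
        exact h.symm) b a
    rw [twist_inv_twist hT] at this
    exact this
  constructor
  · intro a b
    refine unop_injective ?_
    simpa [apply_ite unop] using hy a b
  · intro a b
    refine unop_injective ?_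
    simpa [apply_ite unop] using hy' a b
  · intro f a b
    exact unop_injective (htgt f a b)
  · intro f a b
    exact unop_injective (hsrc f a b)
  · intro f a b
    exact unop_injective (hA.tgt_mul f a b).symm
  · intro f a b
    exact unop_injective (hA.src_mul f a b).symm
  · intro a b c d
    refine unop_injective ?_
    have := exchange_inverse (M := fun a b => entry k L X G deg T σ b a) (N := fun a b => y b a)
      (s := tgt k L X G deg T σ) (t := src k L X G deg T σ) (σ := fun x y a c => σ a c x y) hT
      (fun a b c d => (h41 b a d c).symm)
      (fun a b => by simpa [eq_comm] using hy b a) (fun a b => by simpa [eq_comm] using hy' b a)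
      (fun f a b => hA.src_mul f b a) (fun f a b => (hsrc f b a).symm)
      (fun a b c d => (hA.exchange b a d c).symm) a c d b
    simpa [mul_assoc] using this.symm

variable (k L X G deg T σ)

/-- If `σ` is rigid, then there is a `k`-algebra anti-automorphism `S` of `A_σ` with the
prescribed values on the generators. -/
theorem antiAut_of_isRigid (hT : ∀ (α : G) (f : L), T α (T α⁻¹ f) = f)
    (h41 : ∀ a b c d : X,
      T (deg a)⁻¹ (T (deg c)⁻¹ (σ b d a c)) = T (deg b)⁻¹ (T (deg d)⁻¹ (σ b d a c)))
    (hrig : IsRigid k L X G deg T σ) :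
    ∃ S : Asig k L X G deg T σ →ₗ[k] Asig k L X G deg T σ,
      Function.Bijective S ∧ S 1 = 1 ∧
      (∀ u v : Asig k L X G deg T σ, S (u * v) = S v * S u) ∧
      (∀ f : L, S (mkA k L X G deg T σ (iT k L X (sE k L f))) =
        mkA k L X G deg T σ (iT k L X (tE k L f))) ∧
      (∀ f : L, S (mkA k L X G deg T σ (iT k L X (tE k L f))) =
        mkA k L X G deg T σ (iT k L X (sE k L f))) ∧
      (∀ a b : X, S (mkA k L X G deg T σ (iL k L X a b)) =
        mkA k L X G deg T σ (iLi k L X a b)) := by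
  obtain ⟨x, y, hxy⟩ := hrig
  have hx : ∀ a b, ∑ c, entryInv k L X G deg T σ c b * x a c = if a = b then 1 else 0 :=
    fun a b => (hxy a b).1
  have hx' : ∀ a b, ∑ c, x c b * entryInv k L X G deg T σ a c = if a = b then 1 else 0 :=
    fun a b => (hxy a b).2.1
  have hy : ∀ a b, ∑ c, entry k L X G deg T σ c b * y a c = if a = b then 1 else 0 :=
    fun a b => (hxy a b).2.2.1
  have hy' : ∀ a b, ∑ c, y c b * entry k L X G deg T σ a c = if a = b then 1 else 0 :=
    fun a b => (hxy a b).2.2.2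
  have hA := exchangeRel_Asig k L X G deg T σ
  have hinv : Matrix.of (entryInv k L X G deg T σ) * Matrix.of (entry k L X G deg T σ) = 1 := by
    ext a b
    simp [Matrix.mul_apply, hA.inv_mul, Matrix.one_apply]
  obtain ⟨F, hFs, hFt, hFL, hFi⟩ := exists_antiHom (exchangeRel_antipode hT h41 hx hx')
  obtain ⟨F', hFs', hFt', hFL', hFi'⟩ := exists_antiHom (exchangeRel_antipodeInv hT h41 hy hy')
  have hFy : ∀ a b, unop (F (y a b)) = entry k L X G deg T σ a b := by
    have h : Matrix.of (fun a b => unop (F (y a b))) * Matrix.of (entryInv k L X G deg T σ) = 1 := by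
      ext a b
      have := congrArg (fun z => unop (F z)) (hy a b)
      simpa [Matrix.mul_apply, Matrix.one_apply, hFL, apply_ite F, apply_ite unop] using this
    intro a b
    exact Matrix.ext_iff.2 (left_inv_eq_right_inv h hinv) a b
  have hFx : ∀ a b, unop (F' (x a b)) = entryInv k L X G deg T σ a b := by
    have h : Matrix.of (entry k L X G deg T σ) * Matrix.of (fun a b => unop (F' (x a b))) = 1 := by
      ext a b
      have := congrArg (fun z => unop (F' z)) (hx' a b)
      simpa [Matrix.mul_apply, Matrix.one_apply, hFi', apply_ite F', apply_ite unop] using this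
    intro a b
    exact (Matrix.ext_iff.2 (left_inv_eq_right_inv hinv h) a b).symm
  have hleft : ∀ u, unop (F' (unop (F u))) = u := by
    have : (AlgHom.opComm F').comp F = AlgHom.id k _ := by
      refine algHom_ext_Asig ?_ ?_ ?_ ?_ <;> intros <;>
        simp [AlgHom.opComm, hFs, hFt, hFL, hFi, hFs', hFt', hFi', hFx]
    exact fun u => DFunLike.congr_fun this u
  have hright : ∀ u, unop (F (unop (F' u))) = u := by
    have : (AlgHom.opComm F).comp F' = AlgHom.id k _ := by
      refine algHom_ext_Asig ?_ ?_ ?_ ?_ <;> intros <;>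
        simp [AlgHom.opComm, hFs, hFt, hFL, hFs', hFt', hFL', hFi', hFy]
    exact fun u => DFunLike.congr_fun this u
  refine ⟨(opLinearEquiv k).symm.toLinearMap.comp F.toLinearMap,
    ⟨Function.LeftInverse.injective (g := fun u => unop (F' u)) hleft,
      Function.RightInverse.surjective (g := fun u => unop (F' u)) hright⟩, ?_, fun u v => ?_,
    fun f => ?_, fun f => ?_, fun a b => ?_⟩
  · simp
  · simp
  · exact congrArg unop (hFs f)
  · exact congrArg unop (hFt f)
  · exact congrArg unop (hFL a b)

end
end

section
/- Assume σ satisfies condition (4.1): T_{deg(a)⁻¹}(T_{deg(c)⁻¹}(σ^{bd}_{ac})) = T_{deg(b)⁻¹}(T_{deg(d)⁻¹}(σ^{bd}_{ac})) for all a,b,c,d ∈ X, and assume σ satisfies conditions (1)–(5). Then σ is rigid. -/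
open scoped TensorProduct
open MulOpposite

noncomputable section

set_option linter.unusedSectionVars false

variable (k L X G : Type*) [CommRing k] [Ring L] [Algebra k L] [Fintype X]
  [DecidableEq X] [Group G]

variable (deg : X → G) (T : G → L ≃ₐ[k] L) (σ : X → X → X → X → L)

/-- Multiplying a family `j ↦ ∑ k, q j k * v k` by a row `p` with `p q = eᵢ` recovers `v i`. -/
lemma sum_mul_sum_eq_of_row {A ι κ : Type*} [Ring A] [Fintype ι] [Fintype κ] [DecidableEq κ]
    (p : ι → A) (q : ι → κ → A) (v : κ → A) (i : κ)
    (h : ∀ k, ∑ j, p j * q j k = if k = i then 1 else 0) :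
    ∑ j, p j * ∑ k, q j k * v k = v i := by
  simp_rw [Finset.mul_sum, ← mul_assoc]
  rw [Finset.sum_comm]
  simp_rw [← Finset.sum_mul, h]
  simp

/-- If the transpose of a matrix has a left inverse, then its right inverse is a left inverse. -/
lemma transposed_left_inverse_of_right {A X : Type*} [Ring A] [Fintype X] [DecidableEq X]
    (N x x' : X → X → A)
    (hr : ∀ a b, ∑ c, N c b * x a c = if a = b then 1 else 0)
    (hl : ∀ a b, ∑ c, x' c b * N a c = if a = b then 1 else 0) (a b : X) :
    ∑ c, x c b * N a c = if a = b then 1 else 0 := by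
  have h := left_inv_eq_right_inv
    (a := (Matrix.of fun b c => N c b : Matrix X X A))
    (b := (Matrix.of fun b c => x' c b : Matrix X X A))
    (c := (Matrix.of fun b c => x c b : Matrix X X A))
    (by ext a b; simp [Matrix.mul_apply, Matrix.one_apply, hl, eq_comm])
    (by ext a b; simp [Matrix.mul_apply, Matrix.one_apply, hr, eq_comm])
  rw [← hl]
  exact Finset.sum_congr rfl fun c _ => congrArg (· * N a c) (congrFun (congrFun h b) c).symm

section Representation

variable {L X A : Type*} [Ring L] [Fintype X] [DecidableEq X] [Ring A]
  {s : L →+* A} {t : Lᵐᵒᵖ →+* A} {l m : X → X → A} {τ i : X → X → X → X → L}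

/-- The exchange relation, conjugated by the inverse matrix `m` of `l` on both sides. -/
lemma conjugated_exchange {τs τt : X → L → L} {σ : X → X → X → X → L}
    (hlm : ∀ a b, ∑ c, l a c * m c b = if a = b then 1 else 0)
    (hml : ∀ a b, ∑ c, m a c * l c b = if a = b then 1 else 0)
    (hsm : ∀ f a b, s f * m a b = m a b * s (τs b f))
    (htm : ∀ f a b, t (op f) * m a b = m a b * t (op (τs a f)))
    (hτ : ∀ a f, τs a (τt a f) = f)
    (hex : ∀ a b c d, ∑ x, ∑ y, s (σ x y a c) * l y d * l x b =
      ∑ x, ∑ y, t (op (σ b d x y)) * l c y * l a x) (a d e f : X) :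
    ∑ c, ∑ y, s (τt c (σ f y a c)) * (m e c * l y d) =
      ∑ b, ∑ x, t (op (τt e (σ b d x e))) * (l a x * m b f) := by
  have hL : ∀ c, ∑ b, (∑ x, ∑ y, s (σ x y a c) * l y d * l x b) * m b f =
      ∑ y, s (σ f y a c) * l y d := by
    intro c
    simp_rw [Finset.sum_mul]
    rw [Finset.sum_comm]
    have key : ∀ x, ∑ b, (∑ y, s (σ x y a c) * l y d * l x b) * m b f =
        (∑ y, s (σ x y a c) * l y d) * if x = f then 1 else 0 := by
      intro x
      simp_rw [← hlm, Finset.mul_sum, ← Finset.sum_mul, mul_assoc]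
    simp_rw [Finset.sum_mul] at key
    simp_rw [key]
    simp
  have hR : ∀ b, ∑ c, m e c * (∑ x, ∑ y, t (op (σ b d x y)) * l c y * l a x) =
      ∑ x, t (op (τt e (σ b d x e))) * l a x := by
    intro b
    simp_rw [Finset.mul_sum]
    rw [Finset.sum_comm]
    refine Finset.sum_congr rfl fun x _ => ?_
    rw [Finset.sum_comm]
    have key : ∀ y, ∑ c, m e c * (t (op (σ b d x y)) * l c y * l a x) =
        t (op (τt e (σ b d x y))) * (if e = y then 1 else 0) * l a x := by
      intro y
      rw [← hml, Finset.mul_sum, Finset.sum_mul]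
      refine Finset.sum_congr rfl fun c _ => ?_
      rw [← mul_assoc (t _) (m e c), htm, hτ]
      simp only [mul_assoc]
    simp [key]
  calc _ = ∑ c, m e c * ∑ y, s (σ f y a c) * l y d := by
        refine Finset.sum_congr rfl fun c _ => ?_
        rw [Finset.mul_sum]
        refine Finset.sum_congr rfl fun y _ => ?_
        rw [← mul_assoc, hsm, hτ, mul_assoc]
    _ = ∑ c, m e c * ∑ b, (∑ x, ∑ y, t (op (σ b d x y)) * l c y * l a x) * m b f := by
        simp_rw [← hL, hex]
    _ = ∑ b, (∑ x, t (op (τt e (σ b d x e))) * l a x) * m b f := by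
        simp_rw [← hR, Finset.sum_mul, Finset.mul_sum, mul_assoc]
        rw [Finset.sum_comm]
        simp_rw [← mul_assoc, Finset.sum_mul]
    _ = _ := by simp_rw [Finset.sum_mul, mul_assoc]

/-- The conjugated exchange relation after cancelling the twisted `σ` on both sides. -/
lemma inverted_exchange
    (hst : ∀ f g, s f * t (op g) = t (op g) * s f)
    (hiτ : ∀ w x y z, ∑ a, ∑ b, i w a z b * τ b y a x = if w = x ∧ y = z then 1 else 0)
    (hτi : ∀ w x y z, ∑ a, ∑ b, τ w a z b * i b y a x = if w = x ∧ y = z then 1 else 0)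
    (hE : ∀ a d e f, ∑ c, ∑ y, s (τ f y a c) * (m e c * l y d) =
      ∑ b, ∑ x, t (op (τ b d x e)) * (l a x * m b f)) (w z y b : X) :
    ∑ d, ∑ e, t (op (i e y d b)) * (m e w * l z d) =
      ∑ a, ∑ f, s (i w a z f) * (l a y * m b f) := by
  have hS : ∀ d e, m e w * l z d =
      ∑ a, ∑ f, s (i w a z f) * ∑ b, ∑ x, t (op (τ b d x e)) * (l a x * m b f) := by
    intro d e
    simp_rw [← hE, ← Fintype.sum_prod_type']
    refine (sum_mul_sum_eq_of_row (fun j : X × X => s (i w j.1 z j.2))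
      (fun (j : X × X) (q : X × X) => s (τ j.2 q.2 j.1 q.1))
      (fun q => m e q.1 * l q.2 d) (w, z) fun q => ?_).symm
    simp_rw [← map_mul, ← map_sum, Fintype.sum_prod_type, hiτ]
    rw [apply_ite s, map_one, map_zero]
    simp only [Prod.ext_iff, eq_comm]
  have hT : ∀ a f, ∑ d, ∑ e, t (op (i e y d b)) *
      ∑ b', ∑ x, t (op (τ b' d x e)) * (l a x * m b' f) = l a y * m b f := by
    intro a f
    simp_rw [← Fintype.sum_prod_type']
    refine sum_mul_sum_eq_of_row (fun j : X × X => t (op (i j.2 y j.1 b)))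
      (fun (j : X × X) (q : X × X) => t (op (τ q.1 j.1 q.2 j.2)))
      (fun q => l a q.2 * m q.1 f) (b, y) fun q => ?_
    simp_rw [← map_mul, ← op_mul, ← map_sum, ← Finset.op_sum, Fintype.sum_prod_type, hτi]
    rw [apply_ite op, apply_ite t, op_one, op_zero, map_one, map_zero]
    simp only [Prod.ext_iff, eq_comm]
  simp_rw [← hT]
  simp_rw [hS, ← Fintype.sum_prod_type', Finset.mul_sum]
  rw [Finset.sum_comm]
  simp_rw [← mul_assoc, hst]

/-- Contraction of `inverted_exchange` in which the product `l m` collapses. -/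
lemma contracted_exchange_left
    (hlm : ∀ a b, ∑ c, l a c * m c b = if a = b then 1 else 0)
    (hF : ∀ w z y b, ∑ d, ∑ e, t (op (i e y d b)) * (m e w * l z d) =
      ∑ a, ∑ f, s (i w a z f) * (l a y * m b f))
    {Q : X → X → L} (hQ : ∀ a b, Q a b = ∑ u, i b u a u) (w z : X) :
    ∑ d, ∑ e, t (op (Q d e)) * (m e w * l z d) = s (Q z w) := by
  calc _ = ∑ b, ∑ d, ∑ e, t (op (i e b d b)) * (m e w * l z d) := by
        simp_rw [hQ, Finset.op_sum, map_sum, Finset.sum_mul]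
        symm
        rw [Finset.sum_comm]
        exact Finset.sum_congr rfl fun d _ => Finset.sum_comm
    _ = ∑ a, ∑ f, s (i w a z f) * ∑ b, l a b * m b f := by
        simp_rw [hF, Finset.mul_sum]
        rw [Finset.sum_comm]
        exact Finset.sum_congr rfl fun a _ => Finset.sum_comm
    _ = _ := by simp [hlm, hQ]

/-- Contraction of `inverted_exchange` in which the product `m l` collapses. -/
lemma contracted_exchange_right
    (hml : ∀ a b, ∑ c, m a c * l c b = if a = b then 1 else 0)
    (hF : ∀ w z y b, ∑ d, ∑ e, t (op (i e y d b)) * (m e w * l z d) =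
      ∑ a, ∑ f, s (i w a z f) * (l a y * m b f))
    {Q : X → X → L} (hQ : ∀ a b, Q a b = ∑ u, i u b u a) (b y : X) :
    ∑ a, ∑ f, s (Q f a) * (l a y * m b f) = t (op (Q b y)) := by
  calc _ = ∑ w, ∑ a, ∑ f, s (i w a w f) * (l a y * m b f) := by
        simp_rw [hQ, map_sum, Finset.sum_mul]
        rw [Finset.sum_comm (s := Finset.univ) (t := Finset.univ)
          (f := fun w a => ∑ f, s (i w a w f) * (l a y * m b f))]
        exact Finset.sum_congr rfl fun a _ => Finset.sum_comm
    _ = ∑ d, ∑ e, t (op (i e y d b)) * ∑ w, m e w * l w d := by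
        simp_rw [← hF, Finset.mul_sum]
        rw [Finset.sum_comm]
        exact Finset.sum_congr rfl fun a _ => Finset.sum_comm
    _ = _ := by simp [hml, hQ]

variable {Q Qinv : X → X → L}

lemma transposed_left_inverse_l
    (hP : ∀ w z, ∑ d, ∑ e, t (op (Q d e)) * (m e w * l z d) = s (Q z w))
    (hQinv : ∀ a c, ∑ b, Qinv b c * Q a b = if a = c then 1 else 0) (a b : X) :
    ∑ c, (∑ w, s (Qinv w b) * ∑ e, t (op (Q c e)) * m e w) * l a c =
      if a = b then 1 else 0 := by
  calc _ = ∑ w, s (Qinv w b) * ∑ d, ∑ e, t (op (Q d e)) * (m e w * l a d) := by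
        simp_rw [Finset.sum_mul, Finset.mul_sum, Finset.sum_mul, mul_assoc]
        exact Finset.sum_comm
    _ = _ := by
        simp_rw [hP, ← map_mul, ← map_sum, hQinv]
        rw [apply_ite s, map_one, map_zero]

lemma transposed_left_inverse_m
    (hR : ∀ b y, ∑ a, ∑ f, s (Q f a) * (l a y * m b f) = t (op (Q b y)))
    (hQinv : ∀ a c, ∑ b, Q a b * Qinv b c = if a = c then 1 else 0) (a b : X) :
    ∑ c, (∑ y, t (op (Qinv y b)) * ∑ d, s (Q c d) * l d y) * m a c =
      if a = b then 1 else 0 := by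
  calc _ = ∑ y, t (op (Qinv y b)) * ∑ d, ∑ c, s (Q c d) * (l d y * m a c) := by
        simp_rw [Finset.sum_mul, Finset.mul_sum, Finset.sum_mul, mul_assoc]
        rw [Finset.sum_comm]
        exact Finset.sum_congr rfl fun y _ => Finset.sum_comm
    _ = _ := by
        simp_rw [hR, ← map_mul, ← op_mul, ← map_sum, ← Finset.op_sum, hQinv]
        rw [apply_ite op, apply_ite t, op_one, op_zero, map_one, map_zero]

variable {τs τt : X → L →+* L}

lemma transposed_right_inverse_m
    (hsm : ∀ f a b, s f * m a b = m a b * s (τs b f))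
    (htm : ∀ f a b, t (op f) * m a b = m a b * t (op (τs a f)))
    (hτ : ∀ a f, τs a (τt a f) = f) (hτ' : ∀ a f, τt a (τs a f) = f)
    (hP : ∀ w z, ∑ d, ∑ e, t (op (Q d e)) * (m e w * l z d) = s (Q z w))
    (hQinv : ∀ a c, ∑ b, Qinv a b * τs c (Q b c) = if a = c then 1 else 0) (a b : X) :
    ∑ c, m c b * (∑ z, s (Qinv a z) * ∑ d, t (op (τs c (Q d c))) * l z d) =
      if a = b then 1 else 0 := by
  calc _ = ∑ z, s (τt b (Qinv a z)) * ∑ d, ∑ e, t (op (Q d e)) * (m e b * l z d) := by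
        simp_rw [Finset.mul_sum]
        rw [Finset.sum_comm]
        refine Finset.sum_congr rfl fun z _ => ?_
        rw [Finset.sum_comm]
        refine Finset.sum_congr rfl fun d _ => Finset.sum_congr rfl fun e _ => ?_
        rw [← mul_assoc (t _), htm, mul_assoc, ← mul_assoc (s _) (m e b), hsm, hτ, mul_assoc]
    _ = s (τt b (∑ z, Qinv a z * τs b (Q z b))) := by
        simp_rw [hP, map_sum, map_mul, hτ']
    _ = _ := by rw [hQinv, apply_ite (τt b), apply_ite s]; simp

lemma transposed_right_inverse_l
    (hsl : ∀ f a b, s (τs a f) * l a b = l a b * s f)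
    (htl : ∀ f a b, t (op (τs b f)) * l a b = l a b * t (op f))
    (hτ : ∀ a f, τs a (τt a f) = f)
    (hR : ∀ b y, ∑ a, ∑ f, s (Q f a) * (l a y * m b f) = t (op (Q b y)))
    (hQinv : ∀ a c, ∑ b, τt a (Q b a) * Qinv b c = if a = c then 1 else 0) (a b : X) :
    ∑ c, l c b * (∑ z, t (op (Qinv z a)) * ∑ f, s (τt c (Q f c)) * m z f) =
      if a = b then 1 else 0 := by
  calc _ = ∑ z, t (op (τs b (Qinv z a))) * ∑ c, ∑ f, s (Q f c) * (l c b * m z f) := by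
        simp_rw [Finset.mul_sum]
        rw [Finset.sum_comm]
        refine Finset.sum_congr rfl fun z _ => Finset.sum_congr rfl fun c _ =>
          Finset.sum_congr rfl fun f _ => ?_
        have h : s (Q f c) * l c b = l c b * s (τt c (Q f c)) := by rw [← hsl, hτ]
        rw [← mul_assoc (s (Q f c)), h, mul_assoc (l c b), ← mul_assoc (t (op (τs b _))), htl,
          mul_assoc]
    _ = t (op (τs b (∑ z, τt b (Q z b) * Qinv z a))) := by
        simp_rw [hR, map_sum, map_mul, hτ, Finset.op_sum, op_mul, map_sum, map_mul]
    _ = _ := by rw [hQinv, apply_ite (τs b), apply_ite op, apply_ite t]; simp [eq_comm]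

end Representation

lemma mkA_eq_zero {w : FreeAlgebra k (Gen k L X)} (h : w ∈ relSet k L X G deg T σ) :
    mkA k L X G deg T σ w = 0 :=
  (RingCon.eq _).2 (TwoSidedIdeal.subset_span h)

/-- The canonical ring homomorphism from `L ⊗[k] Lᵐᵒᵖ` to `A_σ`. -/
def tensorToAsig : L ⊗[k] Lᵐᵒᵖ →+* Asig k L X G deg T σ :=
  RingHom.mk'
    { toFun := fun ξ => mkA k L X G deg T σ (iT k L X ξ)
      map_one' := by
        have h := mkA_eq_zero k L X G deg T σ (w := 1 - iT k L X 1) (by simp [relSet])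
        rw [map_sub, map_one, sub_eq_zero] at h
        exact h.symm
      map_mul' := fun ξ ξ' => by
        have h := mkA_eq_zero k L X G deg T σ (Or.inr (Or.inr (Or.inl ⟨ξ, ξ', rfl⟩)))
        rw [map_sub, map_mul, sub_eq_zero] at h
        exact h.symm }
    fun ξ ξ' => by
      have h := mkA_eq_zero k L X G deg T σ (Or.inl ⟨ξ, ξ', rfl⟩)
      rw [map_sub, map_add, sub_eq_zero] at h
      exact h.symm

/-- Under conditions (1)–(5), `σ` satisfying (4.1) is rigid. -/
theorem isRigid_of_conditions (hT : ∀ (α : G) (f : L), T α (T α⁻¹ f) = f)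
    (h41 : ∀ a b c d : X,
      T (deg a)⁻¹ (T (deg c)⁻¹ (σ b d a c)) = T (deg b)⁻¹ (T (deg d)⁻¹ (σ b d a c)))
    (isg : X → X → X → X → L)
    (h1a : ∀ w x' y z : X,
      (∑ a : X, ∑ b : X, isg w a z b * T (deg x')⁻¹ (σ b y a x')) =
        if w = x' ∧ y = z then 1 else 0)
    (h1b : ∀ w x' y z : X,
      (∑ a : X, ∑ b : X, T (deg b)⁻¹ (σ w a z b) * isg b y a x') =
        if w = x' ∧ y = z then 1 else 0)
    (Q Qinv : X → X → L)
    (hQ : ∀ a b : X, Q a b = ∑ u : X, isg u b u a)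
    (hQinv : ∀ a c : X, (∑ b : X, Q a b * Qinv b c) = if a = c then 1 else 0)
    (Q' Q'inv : X → X → L)
    (hQ' : ∀ a b : X, Q' a b = ∑ u : X, isg b u a u)
    (hQ'inv : ∀ a c : X, (∑ b : X, Q'inv b c * Q' a b) = if a = c then 1 else 0)
    (Q'' Q''inv : X → X → L)
    (hQ'' : ∀ a b : X, Q'' a b = ∑ u : X, T (deg b) (isg b u a u))
    (hQ''inv : ∀ a c : X, (∑ b : X, Q''inv a b * Q'' b c) = if a = c then 1 else 0)
    (Q''' Q'''inv : X → X → L)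
    (hQ''' : ∀ a b : X, Q''' a b = ∑ u : X, T (deg a)⁻¹ (isg u a u b))
    (hQ'''inv : ∀ a c : X, (∑ b : X, Q''' a b * Q'''inv b c) = if a = c then 1 else 0) :
    IsRigid k L X G deg T σ := by
  set s : L →+* Asig k L X G deg T σ :=
    (tensorToAsig k L X G deg T σ).comp Algebra.TensorProduct.includeLeftRingHom with hs
  set t : Lᵐᵒᵖ →+* Asig k L X G deg T σ :=
    (tensorToAsig k L X G deg T σ).comp
      (Algebra.TensorProduct.includeRight : Lᵐᵒᵖ →ₐ[k] L ⊗[k] Lᵐᵒᵖ).toRingHom with ht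
  set l : X → X → Asig k L X G deg T σ := fun a b => mkA k L X G deg T σ (iL k L X a b) with hl
  set m : X → X → Asig k L X G deg T σ := fun a b => mkA k L X G deg T σ (iLi k L X a b) with hm
  have hrel := @mkA_eq_zero k L X G _ _ _ _ _ _ deg T σ
  have hst : ∀ f g, s f * t (op g) = t (op g) * s f := fun f g => by
    simp [hs, ht, ← map_mul]
  have hlm : ∀ a b, ∑ c, l a c * m c b = if a = b then 1 else 0 := fun a b => by
    have h := hrel (Or.inr (Or.inr (Or.inr (Or.inl ⟨a, b, rfl⟩))))
    simpa [sub_eq_zero, apply_ite (mkA k L X G deg T σ), hl, hm] using h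
  have hml : ∀ a b, ∑ c, m a c * l c b = if a = b then 1 else 0 := fun a b => by
    have h := hrel (Or.inr (Or.inr (Or.inr (Or.inr (Or.inl ⟨a, b, rfl⟩)))))
    simpa [sub_eq_zero, apply_ite (mkA k L X G deg T σ), hl, hm] using h
  have hsl : ∀ f a b, s (T (deg a) f) * l a b = l a b * s f := fun f a b => by
    have h := hrel (Or.inr (Or.inr (Or.inr (Or.inr (Or.inr (Or.inl ⟨f, a, b, rfl⟩))))))
    simp only [map_sub, map_mul, sub_eq_zero] at h
    exact h
  have htl : ∀ f a b, t (op (T (deg b) f)) * l a b = l a b * t (op f) := fun f a b => by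
    have h := hrel (Or.inr (Or.inr (Or.inr (Or.inr (Or.inr (Or.inr (Or.inl ⟨f, a, b, rfl⟩)))))))
    simp only [map_sub, map_mul, sub_eq_zero] at h
    exact h
  have hsm : ∀ f a b, s f * m a b = m a b * s (T (deg b) f) := fun f a b => by
    have h := hrel (Or.inr (Or.inr (Or.inr (Or.inr (Or.inr (Or.inr (Or.inr
      (Or.inl ⟨f, a, b, rfl⟩))))))))
    simp only [map_sub, map_mul, sub_eq_zero] at h
    exact h
  have htm : ∀ f a b, t (op f) * m a b = m a b * t (op (T (deg a) f)) := fun f a b => by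
    have h := hrel (Or.inr (Or.inr (Or.inr (Or.inr (Or.inr (Or.inr (Or.inr (Or.inr
      (Or.inl ⟨f, a, b, rfl⟩)))))))))
    simp only [map_sub, map_mul, sub_eq_zero] at h
    exact h
  have hex : ∀ a b c d, ∑ x, ∑ y, s (σ x y a c) * l y d * l x b =
      ∑ x, ∑ y, t (op (σ b d x y)) * l c y * l a x := fun a b c d => by
    have h := hrel (Or.inr (Or.inr (Or.inr (Or.inr (Or.inr (Or.inr (Or.inr (Or.inr (Or.inr
      (Or.inl ⟨a, b, c, d, rfl⟩))))))))))
    simp only [map_sub, map_sum, map_mul, sub_eq_zero] at h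
    exact h
  have hT' : ∀ α f, T α⁻¹ (T α f) = f := fun α f => by simpa using hT α⁻¹ f
  have hE := conjugated_exchange (τs := fun a => T (deg a)) (τt := fun a => T (deg a)⁻¹)
    hlm hml hsm htm (fun a f => hT (deg a) f) hex
  have hF := inverted_exchange (i := isg) hst h1a h1b hE
  have hP := contracted_exchange_left hlm hF hQ'
  have hR := contracted_exchange_right hml hF hQ
  let τs : X → L →+* L := fun a => T (deg a)
  let τt : X → L →+* L := fun a => T (deg a)⁻¹
  have hτ : ∀ a f, τs a (τt a f) = f := fun a f => hT (deg a) f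
  have hτ' : ∀ a f, τt a (τs a f) = f := fun a f => hT' (deg a) f
  have hQs : ∀ a b, Q'' a b = τs b (Q' a b) := fun a b => by
    rw [hQ'', hQ', map_sum]
    rfl
  have hQt : ∀ a b, Q''' a b = τt a (Q b a) := fun a b => by
    rw [hQ''', hQ, map_sum]
    rfl
  simp_rw [hQs] at hQ''inv
  simp_rw [hQt] at hQ'''inv
  have hmr := transposed_right_inverse_m (τs := τs) (τt := τt) hsm htm hτ hτ' hP hQ''inv
  have hlr := transposed_right_inverse_l (τs := τs) (τt := τt) hsl htl hτ hR hQ'''inv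
  have hml' := transposed_left_inverse_m hR hQinv
  have hll := transposed_left_inverse_l hP hQ'inv
  have hx := transposed_left_inverse_of_right m _ _ hmr hml'
  have hy := transposed_left_inverse_of_right l _ _ hlr hll
  exact ⟨_, _, fun a b => ⟨hmr a b, hx a b, hlr a b, hy a b⟩⟩

end
end
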